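/- arXiv:2308.11118 — 2 statements merged into one kernel-verified Lean document; each statement's English description precedes it below -/
import Mathlib

section
/- Let m ≥ 1 and let a, b, c ∈ ℕ^m be vectors such that a and b have disjoint supports (no index i has both a_i > 0 and b_i > 0). Then climb(a + c) + climb(b + c) ≥ climb(a) + climb(b). -/
/-- The coordinates of a vector `a ∈ ℕ^m`, numbered `1,…,m`, with value `0` outside
this range (in particular `a_0 = 0`). -/
def coordOf {m : ℕ} (a : Fin m → ℕ) (j : ℕ) : ℕ :=
  if h : 1 ≤ j ∧ j ≤ m then a ⟨j - 1, by omega⟩ else 0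

/-- The climb of a vector `a ∈ ℕ^m`: `Σ_{j=1}^m max(a_j - a_{j-1}, 0)`, with `a_0 = 0`. -/
def climb {m : ℕ} (a : Fin m → ℕ) : ℕ :=
  ∑ j ∈ Finset.Icc 1 m, (coordOf a j - coordOf a (j - 1))

/-- The consecutive vector `e_{[j,k]} ∈ ℕ^m`: the 0/1 vector whose `i`-th coordinate
(coordinates numbered `1,…,m`) is 1 exactly when `j ≤ i ≤ k`. -/
def consecVec (m j k : ℕ) : Fin m → ℕ :=
  fun i => if j ≤ (i : ℕ) + 1 ∧ (i : ℕ) + 1 ≤ k then 1 else 0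

/-- A consecutive vector in `ℕ^m`. -/
def IsConsecVec {m : ℕ} (c : Fin m → ℕ) : Prop :=
  ∃ j k : ℕ, 1 ≤ j ∧ j ≤ k ∧ k ≤ m ∧ c = consecVec m j k

theorem coordOf_zero_right {m : ℕ} (a : Fin m → ℕ) : coordOf a 0 = 0 := by
  simp [coordOf]

theorem coordOf_add {m : ℕ} (a c : Fin m → ℕ) (j : ℕ) :
    coordOf (a + c) j = coordOf a j + coordOf c j := by
  unfold coordOf
  split_ifs <;> simp

theorem coordOf_eq_zero_or {m : ℕ} {a b : Fin m → ℕ} (hdisj : ∀ i, a i = 0 ∨ b i = 0)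
    (j : ℕ) : coordOf a j = 0 ∨ coordOf b j = 0 := by
  unfold coordOf
  split_ifs
  · exact hdisj _
  · exact Or.inl rfl

/-- The partial-sum form of the climb inequality, for sequences: the excess of the first `n`
steps of `a + c` and `b + c` over those of `a` and `b` is at least `c n`. -/
theorem sum_tsub_add_sum_tsub_add_le (a b c : ℕ → ℕ) (hc : c 0 = 0)
    (hdisj : ∀ j, a j = 0 ∨ b j = 0) (n : ℕ) :
    ∑ j ∈ Finset.Icc 1 n, (a j - a (j - 1)) + ∑ j ∈ Finset.Icc 1 n, (b j - b (j - 1)) + c n ≤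
      ∑ j ∈ Finset.Icc 1 n, (a j + c j - (a (j - 1) + c (j - 1))) +
        ∑ j ∈ Finset.Icc 1 n, (b j + c j - (b (j - 1) + c (j - 1))) := by
  induction n with
  | zero => simp [hc]
  | succ n ih =>
    simp only [Finset.sum_Icc_succ_top (Nat.le_add_left 1 n), Nat.add_sub_cancel]
    have h₀ := hdisj n
    have h₁ := hdisj (n + 1)
    omega

/-- If `a, b ∈ ℕ^m` have disjoint supports, then for any `c ∈ ℕ^m`,
`climb(a+c) + climb(b+c) ≥ climb(a) + climb(b)`. -/
theorem climb_add_add_ge (m : ℕ) (hm : 1 ≤ m) (a b c : Fin m → ℕ)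
    (hdisj : ∀ i, a i = 0 ∨ b i = 0) :
    climb a + climb b ≤ climb (a + c) + climb (b + c) := by
  have h := sum_tsub_add_sum_tsub_add_le (coordOf a) (coordOf b) (coordOf c)
    (coordOf_zero_right c) (coordOf_eq_zero_or hdisj) m
  simp only [climb, coordOf_add]
  exact (Nat.le_add_right _ _).trans h
end

section
/- Let m ≥ 1, let b ∈ ℕ^m, and let 1 ≤ j ≤ k ≤ m. Then climb(b) − 1 ≤ climb(b + e_{[j,k]}) ≤ climb(b) + 1. Moreover, climb(b + e_{[j,k]}) = climb(b) + 1 if and only if b_{j−1} ≤ b_j and (k = m or b_k ≥ b_{k+1}), where b_0 is taken to be 0. -/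
theorem coordOf_add_consecVec {m : ℕ} (b : Fin m → ℕ) {j k : ℕ} (hj : 1 ≤ j) (hk : k ≤ m)
    (i : ℕ) :
    coordOf (b + consecVec m j k) i = coordOf b i + if j ≤ i ∧ i ≤ k then 1 else 0 := by
  unfold coordOf
  by_cases h : 1 ≤ i ∧ i ≤ m
  · simp [h, consecVec, Nat.sub_add_cancel h.1]
  · have h' : ¬(j ≤ i ∧ i ≤ k) := by omega
    simp [h, h']

theorem coordOf_eq_zero_of_lt {m : ℕ} (b : Fin m → ℕ) {i : ℕ} (h : m < i) :
    coordOf b i = 0 :=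
  dif_neg (by omega)

/-- The climb gains 1 if `b` does not descend into position `j`, and loses 1 if `b` ascends
out of position `k`. -/
theorem climb_add_consecVec_add {m : ℕ} (b : Fin m → ℕ) {j k : ℕ}
    (hj : 1 ≤ j) (hjk : j ≤ k) (hk : k ≤ m) :
    climb (b + consecVec m j k) + (if coordOf b k < coordOf b (k + 1) then 1 else 0) =
      climb b + if coordOf b (j - 1) ≤ coordOf b j then 1 else 0 := by
  have hloss : (if coordOf b k < coordOf b (k + 1) then 1 else 0) =
      ∑ i ∈ Finset.Icc 1 m,
        if i = k + 1 then (if coordOf b k < coordOf b (k + 1) then 1 else 0) else 0 := by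
    rw [Finset.sum_ite_eq']
    by_cases h : k < m
    · rw [if_pos (Finset.mem_Icc.2 (by omega))]
    · simp [coordOf_eq_zero_of_lt b (show m < k + 1 by omega)]
  have hgain : (if coordOf b (j - 1) ≤ coordOf b j then 1 else 0) =
      ∑ i ∈ Finset.Icc 1 m,
        if i = j then (if coordOf b (j - 1) ≤ coordOf b j then 1 else 0) else 0 := by
    rw [Finset.sum_ite_eq', if_pos (Finset.mem_Icc.2 (by omega))]
  rw [hloss, hgain, climb, climb, ← Finset.sum_add_distrib, ← Finset.sum_add_distrib]
  refine Finset.sum_congr rfl fun i hi => ?_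
  have hi1 := (Finset.mem_Icc.1 hi).1
  rw [coordOf_add_consecVec b hj hk, coordOf_add_consecVec b hj hk]
  rcases eq_or_ne i j with rfl | hij
  · split_ifs <;> omega
  rcases eq_or_ne i (k + 1) with rfl | hik
  · rw [Nat.add_sub_cancel]
    split_ifs <;> omega
  · split_ifs <;> omega

/-- Adding a consecutive vector `e_{[j,k]}` changes the climb by at most 1, and it
increases the climb by exactly 1 iff `b_{j-1} ≤ b_j` and (`k = m` or `b_k ≥ b_{k+1}`),
where `b_0 = 0`. -/
theorem climb_add_consecVec (m : ℕ) (hm : 1 ≤ m) (b : Fin m → ℕ)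
    (j k : ℕ) (hj : 1 ≤ j) (hjk : j ≤ k) (hk : k ≤ m) :
    climb b - 1 ≤ climb (b + consecVec m j k) ∧
    climb (b + consecVec m j k) ≤ climb b + 1 ∧
    (climb (b + consecVec m j k) = climb b + 1 ↔
      coordOf b (j - 1) ≤ coordOf b j ∧ (k = m ∨ coordOf b (k + 1) ≤ coordOf b k)) := by
  have hsum := climb_add_consecVec_add b hj hjk hk
  have hlast : k = m → coordOf b (k + 1) = 0 :=
    fun h => coordOf_eq_zero_of_lt b (by omega)
  split_ifs at hsum <;> omega
end
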